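/- arXiv:1406.4333 — 3 statements merged into one kernel-verified Lean document; each statement's English description precedes it below -/
import Mathlib

section
/- For any four points x₁, x₂, x₃, x₄ ∈ ℝ², let A = (1/2)|Σᵢ₌₁⁴ det(xᵢ, x_{i+1})| be the shoelace area of the quadrilateral (indices mod 4) and let λ = Σᵢ₌₁⁴ ‖x_{i+1} − xᵢ‖² be the sum of its squared side lengths. Then A ≤ (1/4) λ, with equality if and only if x₁x₂x₃x₄ is a square (all four sides have equal length and consecutive sides are orthogonal). -/
open scoped RealInnerProductSpace

/-- Euclidean 2-space. -/
noncomputable abbrev E2 := EuclideanSpace ℝ (Fin 2)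

/-- The 2×2 determinant of two vectors in `ℝ²`. -/
noncomputable def det2 (u v : E2) : ℝ := u 0 * v 1 - u 1 * v 0

theorem norm_sq_eq_coords (u : E2) : ‖u‖ ^ 2 = u 0 ^ 2 + u 1 ^ 2 := by
  simp [EuclideanSpace.norm_sq_eq, Fin.sum_univ_two]

theorem inner_eq_coords (u v : E2) : ⟪u, v⟫ = u 0 * v 0 + u 1 * v 1 := by
  simp [PiLp.inner_apply, Fin.sum_univ_two, mul_comm]

theorem norm_eq_norm_iff_coords (u v : E2) :
    ‖u‖ = ‖v‖ ↔ u 0 ^ 2 + u 1 ^ 2 = v 0 ^ 2 + v 1 ^ 2 := by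
  rw [← norm_sq_eq_coords, ← norm_sq_eq_coords, sq_eq_sq₀ (norm_nonneg _) (norm_nonneg _)]

/-- Twice the area is `|det(p, q)|` for the diagonals `p`, `q`, and `λ ∓ 2 det(p, q)` is a sum of
squares. -/
theorem sum_sq_sides_sub_two_mul_det (a b c d e f g h : ℝ) :
    (c - a) ^ 2 + (d - b) ^ 2 + ((e - c) ^ 2 + (f - d) ^ 2) + ((g - e) ^ 2 + (h - f) ^ 2) +
      ((a - g) ^ 2 + (b - h) ^ 2) -
      2 * ((a * d - b * c) + (c * f - d * e) + (e * h - f * g) + (g * b - h * a)) =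
    (a + e - c - g) ^ 2 + (b + f - d - h) ^ 2 + (g - c + (f - b)) ^ 2 + (h - d - (e - a)) ^ 2 := by
  ring

/-- The version of `sum_sq_sides_sub_two_mul_det` for the opposite orientation. -/
theorem sum_sq_sides_add_two_mul_det (a b c d e f g h : ℝ) :
    (c - a) ^ 2 + (d - b) ^ 2 + ((e - c) ^ 2 + (f - d) ^ 2) + ((g - e) ^ 2 + (h - f) ^ 2) +
      ((a - g) ^ 2 + (b - h) ^ 2) +
      2 * ((a * d - b * c) + (c * f - d * e) + (e * h - f * g) + (g * b - h * a)) =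
    (a + e - c - g) ^ 2 + (b + f - d - h) ^ 2 + (g - c - (f - b)) ^ 2 + (h - d + (e - a)) ^ 2 := by
  ring

theorem eq_zero_of_sum_four_sq_eq_zero {p q r s : ℝ} (h : p ^ 2 + q ^ 2 + r ^ 2 + s ^ 2 = 0) :
    p = 0 ∧ q = 0 ∧ r = 0 ∧ s = 0 := by
  refine ⟨?_, ?_, ?_, ?_⟩ <;> apply pow_eq_zero_iff two_ne_zero |>.mp <;>
    linarith [sq_nonneg p, sq_nonneg q, sq_nonneg r, sq_nonneg s]

/-- For any four points `x₁ x₂ x₃ x₄` in `ℝ²`, the shoelace area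
`A = (1/2)|det(x₁,x₂) + det(x₂,x₃) + det(x₃,x₄) + det(x₄,x₁)|` and the sum of squared side
lengths `λ = ‖x₂−x₁‖² + ‖x₃−x₂‖² + ‖x₄−x₃‖² + ‖x₁−x₄‖²` satisfy `A ≤ (1/4) λ`, with equality
if and only if `x₁x₂x₃x₄` is a square (all four sides of equal length and consecutive sides
orthogonal). -/
theorem quadrilateral_area_le (x₁ x₂ x₃ x₄ : E2) :
    (1 / 2 : ℝ) * |det2 x₁ x₂ + det2 x₂ x₃ + det2 x₃ x₄ + det2 x₄ x₁| ≤
      (1 / 4 : ℝ) * (‖x₂ - x₁‖ ^ 2 + ‖x₃ - x₂‖ ^ 2 + ‖x₄ - x₃‖ ^ 2 + ‖x₁ - x₄‖ ^ 2) ∧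
    ((1 / 2 : ℝ) * |det2 x₁ x₂ + det2 x₂ x₃ + det2 x₃ x₄ + det2 x₄ x₁| =
        (1 / 4 : ℝ) * (‖x₂ - x₁‖ ^ 2 + ‖x₃ - x₂‖ ^ 2 + ‖x₄ - x₃‖ ^ 2 + ‖x₁ - x₄‖ ^ 2) ↔
      ((‖x₂ - x₁‖ = ‖x₃ - x₂‖ ∧ ‖x₃ - x₂‖ = ‖x₄ - x₃‖ ∧ ‖x₄ - x₃‖ = ‖x₁ - x₄‖) ∧
        ⟪x₂ - x₁, x₃ - x₂⟫ = 0 ∧ ⟪x₃ - x₂, x₄ - x₃⟫ = 0 ∧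
        ⟪x₄ - x₃, x₁ - x₄⟫ = 0 ∧ ⟪x₁ - x₄, x₂ - x₁⟫ = 0)) := by
  have hsub := sum_sq_sides_sub_two_mul_det (x₁ 0) (x₁ 1) (x₂ 0) (x₂ 1) (x₃ 0) (x₃ 1) (x₄ 0) (x₄ 1)
  have hadd := sum_sq_sides_add_two_mul_det (x₁ 0) (x₁ 1) (x₂ 0) (x₂ 1) (x₃ 0) (x₃ 1) (x₄ 0) (x₄ 1)
  simp only [norm_eq_norm_iff_coords, norm_sq_eq_coords, inner_eq_coords, det2, PiLp.sub_apply]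
  generalize x₁ 0 = a, x₁ 1 = b, x₂ 0 = c, x₂ 1 = d, x₃ 0 = e, x₃ 1 = f, x₄ 0 = g,
    x₄ 1 = h at *
  set S := (a * d - b * c) + (c * f - d * e) + (e * h - f * g) + (g * b - h * a) with hS
  set L := (c - a) ^ 2 + (d - b) ^ 2 + ((e - c) ^ 2 + (f - d) ^ 2) +
    ((g - e) ^ 2 + (h - f) ^ 2) + ((a - g) ^ 2 + (b - h) ^ 2) with hL
  have hle : |S| ≤ L / 2 := by
    refine abs_le.mpr ⟨?_, ?_⟩
    · have : 0 ≤ L + 2 * S := hadd ▸ by positivity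
      linarith
    · have : 0 ≤ L - 2 * S := hsub ▸ by positivity
      linarith
  refine ⟨by linarith, fun heq => ?_, ?_⟩
  · have hcases : L - 2 * S = 0 ∨ L + 2 * S = 0 := by
      rcases abs_choice S with hs | hs <;> rw [hs] at heq
      · left; linarith
      · right; linarith
    rcases hcases with h0 | h0
    · rw [hsub] at h0
      obtain ⟨h1, h2, h3, h4⟩ := eq_zero_of_sum_four_sq_eq_zero h0
      obtain rfl : g = a + e - c := by linarith
      obtain rfl : h = b + f - d := by linarith
      obtain rfl : f = 2 * c - a - e + b := by linarith
      obtain rfl : d = b + c - e := by linarith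
      refine ⟨⟨?_, ?_, ?_⟩, ?_, ?_, ?_, ?_⟩ <;> ring
    · rw [hadd] at h0
      obtain ⟨h1, h2, h3, h4⟩ := eq_zero_of_sum_four_sq_eq_zero h0
      obtain rfl : g = a + e - c := by linarith
      obtain rfl : h = b + f - d := by linarith
      obtain rfl : f = a + e - 2 * c + b := by linarith
      obtain rfl : d = b + e - c := by linarith
      refine ⟨⟨?_, ?_, ?_⟩, ?_, ?_, ?_, ?_⟩ <;> ring
  · rintro ⟨⟨n1, n2, n3⟩, o1, o2, o3, o4⟩
    have hpar : (a + e - c - g) ^ 2 + (b + f - d - h) ^ 2 + 0 ^ 2 + 0 ^ 2 = 0 := by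
      linarith
    obtain ⟨h1, h2, -, -⟩ := eq_zero_of_sum_four_sq_eq_zero hpar
    obtain rfl : g = a + e - c := by linarith
    obtain rfl : h = b + f - d := by linarith
    have hsq : S ^ 2 = (L / 2) ^ 2 := by
      rw [hS, hL]
      linear_combination
        (-((c - a) ^ 2 + (d - b) ^ 2 - (e - c) ^ 2 - (f - d) ^ 2)) * n1 -
          4 * ((c - a) * (e - c) + (d - b) * (f - d)) * o1
    have hL0 : 0 ≤ L / 2 := (abs_nonneg S).trans hle
    rw [(sq_eq_sq₀ (abs_nonneg S) hL0).mp (by rw [sq_abs, hsq])]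
    ring
end

section
/- (Isoperimetric inequality for triangles.) For any triangle x₁, x₂, x₃ ∈ ℝ², let p = ‖x₂−x₁‖ + ‖x₃−x₂‖ + ‖x₁−x₃‖ be its perimeter and A = (1/2)|det(x₂−x₁, x₃−x₁)| its area. Then A ≤ p²/(12√3), with equality if and only if the triangle is equilateral. Equivalently, the two-dimensional isoperimetric quotient iq₂(x) = A/(C p²) with C = 1/(12√3) satisfies iq₂ ≤ 1 on triangles, with equality exactly for regular triangles. -/
/-- Heron's formula, in terms of the determinant spanned by two sides. -/
theorem four_mul_det2_sq (x₁ x₂ x₃ : E2) :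
    4 * det2 (x₂ - x₁) (x₃ - x₁) ^ 2 =
      (‖x₂ - x₁‖ + ‖x₃ - x₂‖ + ‖x₁ - x₃‖) * (-‖x₂ - x₁‖ + ‖x₃ - x₂‖ + ‖x₁ - x₃‖) *
        (‖x₂ - x₁‖ - ‖x₃ - x₂‖ + ‖x₁ - x₃‖) * (‖x₂ - x₁‖ + ‖x₃ - x₂‖ - ‖x₁ - x₃‖) := by
  have ha := EuclideanSpace.real_norm_sq_eq (x₂ - x₁)
  have hb := EuclideanSpace.real_norm_sq_eq (x₃ - x₂)
  have hc := EuclideanSpace.real_norm_sq_eq (x₁ - x₃)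
  simp only [Fin.sum_univ_two, PiLp.sub_apply] at ha hb hc
  have key (a b c : ℝ) : (a + b + c) * (-a + b + c) * (a - b + c) * (a + b - c) =
      4 * a ^ 2 * c ^ 2 - (a ^ 2 + c ^ 2 - b ^ 2) ^ 2 := by ring
  rw [key, ha, hb, hc]
  simp only [det2, PiLp.sub_apply]
  ring

/-- A quantitative isoperimetric inequality for triangles, with a lower bound for the deficit. -/
theorem perimeter_sq_mul_le_isoperimetric_deficit (x₁ x₂ x₃ : E2) :
    2 * (‖x₂ - x₁‖ + ‖x₃ - x₂‖ + ‖x₁ - x₃‖) ^ 2 *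
        ((‖x₂ - x₁‖ - ‖x₃ - x₂‖) ^ 2 + (‖x₃ - x₂‖ - ‖x₁ - x₃‖) ^ 2 +
          (‖x₁ - x₃‖ - ‖x₂ - x₁‖) ^ 2) ≤
      (‖x₂ - x₁‖ + ‖x₃ - x₂‖ + ‖x₁ - x₃‖) ^ 4 - 108 * det2 (x₂ - x₁) (x₃ - x₁) ^ 2 := by
  have heron := four_mul_det2_sq x₁ x₂ x₃
  have hx : 0 ≤ -‖x₂ - x₁‖ + ‖x₃ - x₂‖ + ‖x₁ - x₃‖ := by
    have := norm_sub_le_norm_sub_add_norm_sub x₂ x₃ x₁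
    rw [norm_sub_rev x₂ x₃, norm_sub_rev x₃ x₁] at this
    linarith
  have hy : 0 ≤ ‖x₂ - x₁‖ - ‖x₃ - x₂‖ + ‖x₁ - x₃‖ := by
    have := norm_sub_le_norm_sub_add_norm_sub x₃ x₁ x₂
    rw [norm_sub_rev x₃ x₁, norm_sub_rev x₁ x₂] at this
    linarith
  have hz : 0 ≤ ‖x₂ - x₁‖ + ‖x₃ - x₂‖ - ‖x₁ - x₃‖ := by
    have := norm_sub_le_norm_sub_add_norm_sub x₁ x₂ x₃
    rw [norm_sub_rev x₁ x₂, norm_sub_rev x₂ x₃] at this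
    linarith
  have ha := norm_nonneg (x₂ - x₁)
  have hb := norm_nonneg (x₃ - x₂)
  have hc := norm_nonneg (x₁ - x₃)
  generalize ‖x₂ - x₁‖ = a at *
  generalize ‖x₃ - x₂‖ = b at *
  generalize ‖x₁ - x₃‖ = c at *
  have h : 0 ≤ 12 * (a + b + c) * ((-a + b + c) * (b - c) ^ 2 + (a - b + c) * (c - a) ^ 2 +
      (a + b - c) * (a - b) ^ 2) := by positivity
  linear_combination h + 27 * heron

/-- Isoperimetric inequality for triangles: for any triangle `x₁ x₂ x₃` in `ℝ²` with perimeter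
`p = ‖x₂−x₁‖ + ‖x₃−x₂‖ + ‖x₁−x₃‖` and area `A = (1/2)|det(x₂−x₁, x₃−x₁)|`, one has
`A ≤ p²/(12√3)`, with equality if and only if the triangle is equilateral.  Equivalently, the
isoperimetric quotient `iq₂ = A/(C p²)` with `C = 1/(12√3)` satisfies `iq₂ ≤ 1` on triangles,
with equality exactly for regular triangles. -/
theorem isoperimetric_triangle (x₁ x₂ x₃ : E2) :
    (1 / 2 : ℝ) * |det2 (x₂ - x₁) (x₃ - x₁)| ≤
      (‖x₂ - x₁‖ + ‖x₃ - x₂‖ + ‖x₁ - x₃‖) ^ 2 / (12 * Real.sqrt 3) ∧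
    ((1 / 2 : ℝ) * |det2 (x₂ - x₁) (x₃ - x₁)| =
        (‖x₂ - x₁‖ + ‖x₃ - x₂‖ + ‖x₁ - x₃‖) ^ 2 / (12 * Real.sqrt 3) ↔
      (‖x₂ - x₁‖ = ‖x₃ - x₂‖ ∧ ‖x₃ - x₂‖ = ‖x₁ - x₃‖)) := by
  have heron := four_mul_det2_sq x₁ x₂ x₃
  have deficit := perimeter_sq_mul_le_isoperimetric_deficit x₁ x₂ x₃
  have ha := norm_nonneg (x₂ - x₁)
  have hb := norm_nonneg (x₃ - x₂)
  have hc := norm_nonneg (x₁ - x₃)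
  generalize ‖x₂ - x₁‖ = a at *
  generalize ‖x₃ - x₂‖ = b at *
  generalize ‖x₁ - x₃‖ = c at *
  generalize det2 (x₂ - x₁) (x₃ - x₁) = d at *
  have hs : 0 < 12 * √3 := by positivity
  have hsq : (1 / 2 * |d| * (12 * √3)) ^ 2 = 108 * d ^ 2 := by
    rw [mul_pow, mul_pow, mul_pow, sq_abs, Real.sq_sqrt (by norm_num)]
    ring
  have hl : 0 ≤ 1 / 2 * |d| * (12 * √3) := by positivity
  rw [le_div_iff₀ hs, eq_div_iff hs.ne', ← sq_le_sq₀ hl (sq_nonneg _),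
    ← sq_eq_sq₀ hl (sq_nonneg _), hsq]
  refine ⟨?_, fun h ↦ ?_, ?_⟩
  · have : 0 ≤ 2 * (a + b + c) ^ 2 * ((a - b) ^ 2 + (b - c) ^ 2 + (c - a) ^ 2) := by positivity
    linarith
  · obtain hp | hp := (add_nonneg (add_nonneg ha hb) hc).eq_or_lt
    · constructor <;> linarith
    · have hle : (a - b) ^ 2 + (b - c) ^ 2 + (c - a) ^ 2 ≤ 0 := by
        refine nonpos_of_mul_nonpos_right (a := 2 * (a + b + c) ^ 2) ?_ (by positivity)
        linarith
      constructor <;> nlinarith [sq_nonneg (a - b), sq_nonneg (b - c), sq_nonneg (c - a)]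
  · rintro ⟨rfl, rfl⟩
    linear_combination 27 * heron
end

section
/- (Concavity of q₂ in an interior vertex.) Let x₁,…,xₙ ∈ ℝ² (n ≥ 3) be the closed link of an interior vertex, with indices taken cyclically (x_{n+1} = x₁), and let C ≥ 0. Then the function q₂(x₀) = Σᵢ₌₁ⁿ [ (1/2) det(xᵢ − x₀, x_{i+1} − x₀) − C (‖xᵢ − x₀‖ + ‖x_{i+1} − xᵢ‖ + ‖x₀ − x_{i+1}‖)² ], i.e. the sum over the triangles adjacent to x₀ of the element quality area − C·perim², is a concave function of x₀ ∈ ℝ²; indeed its first summand is constant in x₀ and its second summand is concave. -/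
/-- Moving the base point changes the determinant by terms linear in the edge vector. -/
theorem det2_sub_sub (a b p : E2) :
    det2 (a - p) (b - p) = det2 a b - p 0 * (b 1 - a 1) + p 1 * (b 0 - a 0) := by
  simp only [det2, PiLp.sub_apply]
  ring

/-- The signed area of a closed polygon does not depend on the base point. -/
theorem sum_det2_sub_sub (n : ℕ) [NeZero n] (x : Fin n → E2) (p : E2) :
    ∑ i, det2 (x i - p) (x (i + 1) - p) = ∑ i, det2 (x i) (x (i + 1)) := by
  have shift (k : Fin 2) : ∑ i, x (i + 1) k = ∑ i, x i k :=
    Equiv.sum_comp (Equiv.addRight 1) fun i => x i k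
  simp only [det2_sub_sub, Finset.sum_add_distrib, Finset.sum_sub_distrib, ← Finset.mul_sum,
    shift, sub_self, mul_zero, sub_zero, add_zero]

/-- The squared perimeter of a triangle is a convex function of one of its vertices. -/
theorem convexOn_sq_perimeter {E : Type*} [NormedAddCommGroup E] [NormedSpace ℝ E] (a b : E) :
    ConvexOn ℝ Set.univ fun p : E => (‖a - p‖ + ‖b - a‖ + ‖p - b‖) ^ 2 := by
  have ha : ConvexOn ℝ Set.univ fun p : E => ‖a - p‖ := by
    simpa only [dist_eq_norm, norm_sub_rev] using convexOn_univ_dist a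
  have hb : ConvexOn ℝ Set.univ fun p : E => ‖p - b‖ := by
    simpa only [dist_eq_norm] using convexOn_univ_dist b
  exact ((ha.add_const ‖b - a‖).add hb).pow (fun p _ => by
    change 0 ≤ ‖a - p‖ + ‖b - a‖ + ‖p - b‖
    positivity) 2

/-- A finite sum of real-valued convex functions is convex. -/
theorem convexOn_finset_sum {E ι : Type*} [AddCommGroup E] [Module ℝ E] {s : Set E}
    (hs : Convex ℝ s) {f : ι → E → ℝ} (t : Finset ι) (hf : ∀ i, ConvexOn ℝ s (f i)) :
    ConvexOn ℝ s fun p => ∑ i ∈ t, f i p := by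
  classical
  induction t using Finset.induction_on with
  | empty => simpa using convexOn_const (0 : ℝ) hs
  | insert i t hi ih =>
    simp only [Finset.sum_insert hi]
    exact (hf i).add ih

/-- Concavity of `q₂` in an interior vertex: if `x 0, …, x (n-1)` (indices cyclic, `n ≥ 3`) is
the closed link of an interior vertex and `C ≥ 0`, then
`q₂(x₀) = ∑ᵢ [(1/2) det(xᵢ − x₀, x_{i+1} − x₀) − C(‖xᵢ − x₀‖ + ‖x_{i+1} − xᵢ‖ + ‖x₀ − x_{i+1}‖)²]`,
the sum over the triangles adjacent to `x₀` of the element quality `area − C·perim²`, is a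
concave function of `x₀`. -/
theorem q2_concave_in_interior_vertex (n : ℕ) [NeZero n] (hn : 3 ≤ n)
    (x : Fin n → E2) (C : ℝ) (hC : 0 ≤ C) :
    ConcaveOn ℝ Set.univ
      (fun x₀ : E2 => ∑ i : Fin n,
        ((1 / 2 : ℝ) * det2 (x i - x₀) (x (i + 1) - x₀) -
          C * (‖x i - x₀‖ + ‖x (i + 1) - x i‖ + ‖x₀ - x (i + 1)‖) ^ 2)) := by
  have hconv : ConvexOn ℝ Set.univ fun p : E2 =>
      ∑ i, C * (‖x i - p‖ + ‖x (i + 1) - x i‖ + ‖p - x (i + 1)‖) ^ 2 :=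
    convexOn_finset_sum convex_univ _ fun i =>
      (convexOn_sq_perimeter (x i) (x (i + 1))).smul hC
  have harea (p : E2) : ∑ i, (1 / 2 : ℝ) * det2 (x i - p) (x (i + 1) - p) =
      1 / 2 * ∑ i, det2 (x i) (x (i + 1)) := by
    rw [← Finset.mul_sum, sum_det2_sub_sub]
  simp only [Finset.sum_sub_distrib, harea]
  exact (concaveOn_const _ convex_univ).sub hconv
end
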